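/- arXiv:cs/0511023 — 3 statements merged into one kernel-verified Lean document; each statement's English description precedes it below -/
import Mathlib

section
/- For every NPLCS N=(L,τ) with location set Q and every scheduler U, the set Q_ε = {(q,ε) : q ∈ Q} of configurations with all channels empty is a finite attractor for U: for every starting configuration s, Pr_U(s ⊨ □◇Q_ε) = 1, i.e., under any scheduler almost all infinite paths visit configurations with all channels empty infinitely often. -/
open scoped ENNReal
open Classical

namespace NPLCSmodel

/-! ## Lossy channel systems -/

/-- Operations of a lossy channel system: send a message on a channel,
receive a message from a channel, or an internal action. -/
inductive LcsOp (C M : Type) : Type where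
  | send : C → M → LcsOp C M
  | recv : C → M → LcsOp C M
  | internal : LcsOp C M

def LcsOp.IsRecv {C M : Type} : LcsOp C M → Prop
  | .recv _ _ => True
  | _ => False

/-- A transition rule `src --op--> dst`. -/
structure LcsRule (Q C M : Type) : Type where
  src : Q
  op : LcsOp C M
  dst : Q

/-- Channel contents: a word over `M` for each channel. -/
abbrev Chans (C M : Type) : Type := C → List M

/-- Configurations: a location together with channel contents. -/
abbrev Conf (Q C M : Type) : Type := Q × Chans C M

/-- The empty channel contents ε. -/
def eps (C M : Type) : Chans C M := fun _ => []

variable {Q C M : Type}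

/-- When is an operation possible on channel contents `w`? -/
def enabledOp : LcsOp C M → Chans C M → Prop
  | .recv c m, w => ∃ v, w c = m :: v
  | .send _ _, _ => True
  | .internal, _ => True

/-- Effect of an operation on the channel contents (for a perfect step). -/
def applyOp [DecidableEq C] : LcsOp C M → Chans C M → Chans C M
  | .send c m, w => Function.update w c (w c ++ [m])
  | .recv c _, w => Function.update w c (w c).tail
  | .internal, w => w

/-- A rule is enabled in a configuration. -/
def LcsRule.EnabledIn (δ : LcsRule Q C M) (s : Conf Q C M) : Prop :=
  δ.src = s.1 ∧ enabledOp δ.op s.2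

/-- A lossy channel system `L = (Q, C, M, Δ)` (the finiteness of the location,
channel and message types is imposed by `Fintype` assumptions at use sites):
a finite set of transition rules such that every location has at least one
outgoing rule that is not a receive. -/
structure LCS (Q C M : Type) : Type where
  rules : Set (LcsRule Q C M)
  finiteRules : rules.Finite
  noDeadlock : ∀ q : Q, ∃ δ ∈ rules, δ.src = q ∧ ¬ δ.op.IsRecv

variable [DecidableEq C]

/-- Lossy step via rule `δ`: a perfect step followed by losing arbitrarily
many messages (`<+` is the (componentwise) subword relation). -/
def LCS.StepVia (L : LCS Q C M) (s : Conf Q C M) (δ : LcsRule Q C M)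
    (t : Conf Q C M) : Prop :=
  δ ∈ L.rules ∧ δ.EnabledIn s ∧ t.1 = δ.dst ∧ ∀ c, List.Sublist (t.2 c) (applyOp δ.op s.2 c)

/-- Lossy step `s → t`. -/
def LCS.Step (L : LCS Q C M) (s t : Conf Q C M) : Prop := ∃ δ, L.StepVia s δ t

/-- Reachability `s →* t`. -/
def LCS.Reach (L : LCS Q C M) : Conf Q C M → Conf Q C M → Prop :=
  Relation.ReflTransGen L.Step

/-- Constrained reachability `s →*_[X) t`: all configurations along the path,
except possibly the last one, have their location in `X`. -/
def LCS.ReachWithin (L : LCS Q C M) (X : Set Q) : Conf Q C M → Conf Q C M → Prop :=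
  Relation.ReflTransGen (fun a b => L.Step a b ∧ a.1 ∈ X)

/-- Constrained reachability `s →*_[X] t`: all configurations along the path,
including `s` and `t`, have their location in `X`. -/
def LCS.ReachConstrained (L : LCS Q C M) (X : Set Q) (s t : Conf Q C M) : Prop :=
  L.ReachWithin X s t ∧ t.1 ∈ X

/-- `X` is safe for `A`. -/
def LCS.IsSafeFor (L : LCS Q C M) (A X : Set Q) : Prop :=
  X ⊆ A ∧ ∀ x ∈ X, ∃ t, L.Step (x, eps C M) t ∧ t.1 ∈ X

/-- `Safe(A)`: the largest set safe for `A` (the union of all such sets). -/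
def LCS.Safe (L : LCS Q C M) (A : Set Q) : Set Q := ⋃₀ {X | L.IsSafeFor A X}

/-- `X` is promising for `A`. -/
def LCS.IsPromisingFor (L : LCS Q C M) (A X : Set Q) : Prop :=
  ∀ x ∈ X, ∃ t, L.ReachWithin X (x, eps C M) t ∧ t.1 ∈ A

/-- `Prom(A)`: the largest set promising for `A` (the union of all such sets). -/
def LCS.Prom (L : LCS Q C M) (A : Set Q) : Set Q := ⋃₀ {X | L.IsPromisingFor A X}

/-! ## NPLCS and the induced Markov decision process -/

/-- An NPLCS: an LCS together with a fault rate `τ ∈ (0,1)`. -/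
structure NPLCS (Q C M : Type) : Type where
  L : LCS Q C M
  τ : ℝ
  τ_pos : 0 < τ
  τ_lt_one : τ < 1

/-- The number of embeddings of the second list as a subword of the first. -/
def countEmb [DecidableEq M] : List M → List M → ℕ
  | _, [] => 1
  | [], _ :: _ => 0
  | a :: v, b :: w => (if a = b then countEmb v w else 0) + countEmb v (b :: w)

variable [Fintype C] [DecidableEq M]

/-- Total number of messages in the channels. -/
def chansSize (w : Chans C M) : ℕ := ∑ c, (w c).length

/-- `P_lost(v,v') = τ^(|v|-|v'|) · (1-τ)^|v'| · C(v,v')`, the probability that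
channel contents `v` become `v'` through message losses. -/
noncomputable def plost (τ : ℝ) (v v' : Chans C M) : ℝ≥0∞ :=
  ENNReal.ofReal
    (τ ^ (chansSize v - chansSize v') * (1 - τ) ^ chansSize v' *
      (∏ c, countEmb (v c) (v' c) : ℕ))

/-- One-step probability `P_N(s, δ, t)` of the MDP of an NPLCS. -/
noncomputable def NPLCS.stepProb (N : NPLCS Q C M) (s : Conf Q C M)
    (δ : LcsRule Q C M) (t : Conf Q C M) : ℝ≥0∞ :=
  if δ ∈ N.L.rules ∧ δ.EnabledIn s ∧ t.1 = δ.dst then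
    plost N.τ (applyOp δ.op s.2) t.2
  else 0

/-! ## Probability measure of a countable-state Markov chain

Given one-step probabilities `k` on a state space `S`, the measure of a set of
trajectories is the Carathéodory outer measure generated by the probabilities
of cylinder sets; it agrees with the usual Markov-chain measure on all
measurable (in particular, on all ω-regular) sets of trajectories. -/

section Chain
variable {S : Type}

/-- Probability that the chain starting in `s` performs the finite sequence
of steps through the configurations listed in `l`. -/
noncomputable def chainPathProb (k : S → S → ℝ≥0∞) : S → List S → ℝ≥0∞
  | _, [] => 1
  | s, t :: l => k s t * chainPathProb k t l

/-- The cylinder of trajectories starting with `s` followed by `l`. -/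
def chainCyl (s : S) (l : List S) : Set (ℕ → S) :=
  {ω | ω 0 = s ∧ ∀ (i : ℕ) (h : i < l.length), ω (i + 1) = l.get ⟨i, h⟩}

/-- Premeasure: probability of a cylinder set, `∞` on other (nonempty) sets. -/
noncomputable def chainFun (k : S → S → ℝ≥0∞) (s : S) (A : Set (ℕ → S)) : ℝ≥0∞ :=
  if A = ∅ then 0 else ⨅ (l : List S) (_ : A = chainCyl s l), chainPathProb k s l

theorem chainFun_empty (k : S → S → ℝ≥0∞) (s : S) : chainFun k s ∅ = 0 := by
  simp [chainFun]

/-- The probability, for the Markov chain with one-step probabilities `k`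
started in `s`, of the set `E` of trajectories (paths starting in `s`). -/
noncomputable def chainPr (k : S → S → ℝ≥0∞) (s : S) (E : Set (ℕ → S)) : ℝ≥0∞ :=
  MeasureTheory.OuterMeasure.ofFunction (chainFun k s) (chainFun_empty k s)
    (E ∩ {ω | ω 0 = s})

end Chain

/-! ## Schedulers -/

/-- A (history-dependent, deterministic) scheduler: given the history
`h = s₁ → ⋯ → s_{n-1}` and the current configuration `sₙ`, it chooses a
transition rule of `N` enabled in `sₙ`. -/
structure Scheduler (N : NPLCS Q C M) : Type where
  choose : List (Conf Q C M) → Conf Q C M → LcsRule Q C M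
  choose_mem : ∀ h s, choose h s ∈ N.L.rules
  choose_enabled : ∀ h s, (choose h s).EnabledIn s

variable {N : NPLCS Q C M}

/-- The Markov chain `MC_U` induced by a scheduler: its states are finite
paths, represented as (history, current configuration). -/
noncomputable def Scheduler.kernel (U : Scheduler N) :
    List (Conf Q C M) × Conf Q C M → List (Conf Q C M) × Conf Q C M → ℝ≥0∞ :=
  fun a b =>
    if b.1 = a.1 ++ [a.2] then N.stepProb a.2 (U.choose a.1 a.2) b.2 else 0

/-- `Pr_U(s ⊨ E)`: the probability, under scheduler `U` with starting
configuration `s`, of the set `E` of infinite paths (trajectories of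
configurations). -/
noncomputable def Scheduler.Pr (U : Scheduler N) (s : Conf Q C M)
    (E : Set (ℕ → Conf Q C M)) : ℝ≥0∞ :=
  chainPr U.kernel ([], s) {ω | (fun i => (ω i).2) ∈ E}

/-- Memoryless scheduler: the decision depends only on the current
configuration. -/
def Scheduler.Memoryless (U : Scheduler N) : Prop :=
  ∀ h h' s, U.choose h s = U.choose h' s

/-- Blind scheduler: the decision depends only on the sequence of locations
that have been visited. -/
def Scheduler.Blind (U : Scheduler N) : Prop :=
  ∀ h h' s s', h.map Prod.fst = h'.map Prod.fst → s.1 = s'.1 →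
    U.choose h s = U.choose h' s'

/-- Finite-memory scheduler data: finitely many modes, a starting mode, a
decision rule and a next-mode function. -/
structure FMScheduler (N : NPLCS Q C M) : Type 1 where
  Mode : Type
  modeFin : Fintype Mode
  init : Mode
  D : Mode → Conf Q C M → LcsRule Q C M
  upd : Mode → Conf Q C M → Mode
  D_mem : ∀ u s, D u s ∈ N.L.rules
  D_enabled : ∀ u s, (D u s).EnabledIn s

/-- A scheduler is finite-memory if it is induced by finite-memory data. -/
def Scheduler.FiniteMemory (U : Scheduler N) : Prop :=
  ∃ fm : FMScheduler N, ∀ h s, U.choose h s = fm.D (h.foldl fm.upd fm.init) s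

/-- The Markov chain `MC_U` of a finite-memory scheduler: states are pairs
`s_u` of a configuration `s` and a mode `u`. -/
noncomputable def FMScheduler.kernel (fm : FMScheduler N) :
    Conf Q C M × fm.Mode → Conf Q C M × fm.Mode → ℝ≥0∞ :=
  fun a b =>
    if b.2 = fm.upd a.2 a.1 then N.stepProb a.1 (fm.D a.2 a.1) b.1 else 0

/-- Probability measure of the Markov chain `MC_U` of a finite-memory
scheduler, over trajectories of (configuration, mode) states. -/
noncomputable def FMScheduler.PrMC (fm : FMScheduler N)
    (a : Conf Q C M × fm.Mode) (E : Set (ℕ → Conf Q C M × fm.Mode)) : ℝ≥0∞ :=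
  chainPr fm.kernel a E

/-- Reachability in the Markov chain `MC_U` of a finite-memory scheduler. -/
def FMScheduler.MCReach (fm : FMScheduler N) :
    Conf Q C M × fm.Mode → Conf Q C M × fm.Mode → Prop :=
  Relation.ReflTransGen (fun a b => 0 < fm.kernel a b)

/-- The history (the first `i` configurations) of a trajectory. -/
def histTo (ω : ℕ → Conf Q C M) (i : ℕ) : List (Conf Q C M) :=
  (List.range i).map ω

/-- Almost blind scheduler: there are a scheduler `W` and a blind scheduler
`V` such that from any starting configuration, almost surely the choices of
`U` along the path agree with those of `W` up to some finite time and with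
those of `V` afterwards. -/
def Scheduler.AlmostBlind (U : Scheduler N) : Prop :=
  ∃ W V : Scheduler N, V.Blind ∧ ∀ s : Conf Q C M,
    U.Pr s {ω | ∃ n : ℕ,
      (∀ i ≤ n, U.choose (histTo ω i) (ω i) = W.choose (histTo ω i) (ω i)) ∧
      (∀ i, n < i → U.choose (histTo ω i) (ω i) = V.choose (histTo ω i) (ω i))} = 1

/-! ## LTL-style events on trajectories -/

/-- `□P` -/
def evAlways {α : Type} (P : α → Prop) : Set (ℕ → α) := {ω | ∀ i, P (ω i)}

/-- `◇P` -/
def evEventually {α : Type} (P : α → Prop) : Set (ℕ → α) := {ω | ∃ i, P (ω i)}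

/-- `□◇P` -/
def evInfOften {α : Type} (P : α → Prop) : Set (ℕ → α) :=
  {ω | ∀ n, ∃ i, n ≤ i ∧ P (ω i)}

/-- `◇□P` -/
def evEvAlways {α : Type} (P : α → Prop) : Set (ℕ → α) :=
  {ω | ∃ n, ∀ i, n ≤ i → P (ω i)}

/-- The atomic proposition "the current location belongs to `A`". -/
def inLoc (A : Set Q) : Conf Q C M → Prop := fun s => s.1 ∈ A


/-! ## General facts on trajectory probabilities of a chain -/

section ChainFacts
variable {S : Type}

/-- The trajectory that starts with `s` and continues with `ω`. -/
def prependState (s : S) (ω : ℕ → S) : ℕ → S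
  | 0 => s
  | n + 1 => ω n

theorem prependState_shift {s : S} {ω : ℕ → S} (h : ω 0 = s) :
    prependState s (fun n => ω (n + 1)) = ω := by
  funext n
  cases n with
  | zero => exact h.symm
  | succ n => rfl

theorem image_prependState_chainCyl (s b : S) (l : List S) :
    prependState s '' chainCyl b l = chainCyl s (b :: l) := by
  ext ω
  constructor
  · rintro ⟨ω', ⟨h0, h⟩, rfl⟩
    refine ⟨rfl, fun i hi => ?_⟩
    cases i with
    | zero => exact h0
    | succ i => exact h i (by simpa using hi)
  · rintro ⟨h0, h⟩
    refine ⟨fun n => ω (n + 1), ⟨h 0 (by simp), fun i hi => ?_⟩, prependState_shift h0⟩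
    exact h (i + 1) (by simpa using hi)

theorem chainFun_chainCyl_le (k : S → S → ℝ≥0∞) (s : S) (l : List S) :
    chainFun k s (chainCyl s l) ≤ chainPathProb k s l := by
  unfold chainFun
  split_ifs
  · exact zero_le
  · exact iInf₂_le (f := fun l' (_ : chainCyl s l = chainCyl s l') => chainPathProb k s l') l rfl

theorem ofFunction_chainCyl_le (k : S → S → ℝ≥0∞) (s : S) (l : List S) :
    MeasureTheory.OuterMeasure.ofFunction (chainFun k s) (chainFun_empty k s) (chainCyl s l)
      ≤ chainPathProb k s l :=
  (MeasureTheory.OuterMeasure.ofFunction_le _).trans (chainFun_chainCyl_le k s l)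

theorem chainPr_mono (k : S → S → ℝ≥0∞) (s : S) {E F : Set (ℕ → S)} (h : E ⊆ F) :
    chainPr k s E ≤ chainPr k s F :=
  MeasureTheory.measure_mono (μ := MeasureTheory.OuterMeasure.ofFunction _ (chainFun_empty k s))
    (Set.inter_subset_inter_left _ h)

theorem chainPr_le_one (k : S → S → ℝ≥0∞) (s : S) (E : Set (ℕ → S)) : chainPr k s E ≤ 1 := by
  refine le_trans ?_ (ofFunction_chainCyl_le k s [])
  refine MeasureTheory.measure_mono fun ω hω => ⟨hω.2, fun i hi => ?_⟩
  simp at hi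

theorem ofFunction_image_prependState_le (k : S → S → ℝ≥0∞) {s b : S} (hk : k s b ≠ ⊤)
    {F : Set (ℕ → S)} (hF : F ⊆ {ω | ω 0 = b}) :
    MeasureTheory.OuterMeasure.ofFunction (chainFun k s) (chainFun_empty k s)
        (prependState s '' F) ≤
      k s b * MeasureTheory.OuterMeasure.ofFunction (chainFun k b) (chainFun_empty k b) F := by
  have hcyl : ∀ l, MeasureTheory.OuterMeasure.ofFunction (chainFun k s) (chainFun_empty k s)
      (prependState s '' chainCyl b l) ≤ k s b * chainPathProb k b l := fun l => by
    rw [image_prependState_chainCyl]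
    exact ofFunction_chainCyl_le k s (b :: l)
  rcases eq_or_ne (k s b) 0 with h0 | h0
  · rw [h0, zero_mul]
    refine (MeasureTheory.measure_mono (Set.image_mono ?_)).trans ((hcyl []).trans ?_)
    · exact fun ω hω => ⟨hF hω, fun i hi => by simp at hi⟩
    · simp [h0]
  · have key : MeasureTheory.OuterMeasure.comap (prependState s)
        (MeasureTheory.OuterMeasure.ofFunction (chainFun k s) (chainFun_empty k s)) ≤
        k s b • MeasureTheory.OuterMeasure.ofFunction (chainFun k b) (chainFun_empty k b) := by
      rw [MeasureTheory.OuterMeasure.smul_ofFunction hk, MeasureTheory.OuterMeasure.le_ofFunction]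
      intro A
      rw [MeasureTheory.OuterMeasure.comap_apply, Pi.smul_apply, smul_eq_mul]
      unfold chainFun
      split_ifs with hA
      · simp [hA]
      · rw [ENNReal.mul_iInf_of_ne h0 hk]
        refine le_iInf fun l => ?_
        rw [ENNReal.mul_iInf_of_ne h0 hk]
        refine le_iInf fun hl => ?_
        rw [hl]
        exact hcyl l
    exact key F

/-- One-step decomposition of trajectory probabilities. -/
theorem chainPr_le_tsum [Countable S] (k : S → S → ℝ≥0∞) (s : S) (hk : ∀ b, k s b ≠ ⊤)
    (E : Set (ℕ → S)) :
    chainPr k s E ≤ ∑' b, k s b * chainPr k b {ω | prependState s ω ∈ E} := by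
  have hsub : E ∩ {ω | ω 0 = s} ⊆
      ⋃ b, prependState s '' ({ω | prependState s ω ∈ E} ∩ {ω | ω 0 = b}) := by
    rintro ω ⟨hE, h0⟩
    have hω := prependState_shift h0
    refine Set.mem_iUnion.2 ⟨ω 1, fun n => ω (n + 1), ⟨?_, rfl⟩, hω⟩
    simpa [hω] using hE
  calc chainPr k s E ≤ _ := MeasureTheory.measure_mono hsub
    _ ≤ _ := MeasureTheory.measure_iUnion_le _
    _ ≤ _ := ENNReal.tsum_le_tsum fun b =>
      ofFunction_image_prependState_le k (hk b) Set.inter_subset_right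

/-- What remains to be followed of a prescribed path after a step to `b`
(`none` if the path has been left). -/
noncomputable def residualPath : Option (List S) → S → Option (List S)
  | none, _ => none
  | some [], _ => some []
  | some (c :: l), b => if b = c then some l else none

/-- Probability of following a prescribed path. -/
noncomputable def residualProb (k : S → S → ℝ≥0∞) (s : S) : Option (List S) → ℝ≥0∞
  | none => 0
  | some l => chainPathProb k s l

theorem tsum_mul_residualProb (k : S → S → ℝ≥0∞) (a : S) (hk : ∑' b, k a b = 1)
    (o : Option (List S)) :
    ∑' b, k a b * residualProb k b (residualPath o b) = residualProb k a o := by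
  match o with
  | none => simp [residualPath, residualProb]
  | some [] => simp [residualPath, residualProb, chainPathProb, hk]
  | some (c :: l) =>
    rw [tsum_eq_single c]
    · simp [residualPath, residualProb, chainPathProb]
    · intro b hb
      simp [residualPath, residualProb, hb]

theorem exists_tsum_residualProb_lt_one {ι : Type} (k : S → S → ℝ≥0∞) (a : S)
    (hk : ∑' b, k a b = 1) (L : ι → Option (List S)) (hL : ∑' i, residualProb k a (L i) < 1) :
    ∃ b, ∑' i, residualProb k b (residualPath (L i) b) < 1 := by
  by_contra! h
  refine hL.not_ge ?_
  calc (1 : ℝ≥0∞) = ∑' b, k a b * 1 := by simp [hk]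
    _ ≤ ∑' b, k a b * ∑' i, residualProb k b (residualPath (L i) b) := by
      gcongr with b
      exact h b
    _ = ∑' b, ∑' i, k a b * residualProb k b (residualPath (L i) b) := by
      simp only [ENNReal.tsum_mul_left]
    _ = ∑' i, ∑' b, k a b * residualProb k b (residualPath (L i) b) := ENNReal.tsum_comm
    _ = ∑' i, residualProb k a (L i) := by simp only [tsum_mul_residualProb k a hk]

/-- Prescribed paths of total probability less than one do not exhaust the trajectories. -/
theorem exists_trajectory_notMem_chainCyl {ι : Type} (k : S → S → ℝ≥0∞)
    (hk : ∀ a, ∑' b, k a b = 1) (s : S) (L : ι → Option (List S))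
    (hL : ∑' i, residualProb k s (L i) < 1) :
    ∃ ω : ℕ → S, ω 0 = s ∧ ∀ i l, L i = some l → ω ∉ chainCyl s l := by
  choose! next hnext using fun (a : S) (L : ι → Option (List S))
    (h : ∑' i, residualProb k a (L i) < 1) => exists_tsum_residualProb_lt_one k a (hk a) L h
  let step : S × (ι → Option (List S)) → S × (ι → Option (List S)) :=
    fun p => (next p.1 p.2, fun i => residualPath (p.2 i) (next p.1 p.2))
  let p : ℕ → S × (ι → Option (List S)) := fun n => step^[n] (s, L)
  have hp : ∀ n, p (n + 1) = step (p n) := fun n => Function.iterate_succ_apply' step n _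
  have hlt : ∀ n, ∑' i, residualProb k (p n).1 ((p n).2 i) < 1 := by
    intro n
    induction n with
    | zero => exact hL
    | succ n ih =>
      rw [hp]
      exact hnext _ _ ih
  refine ⟨fun n => (p n).1, rfl, fun i l hl hω => ?_⟩
  have hdrop : ∀ n, (p n).2 i = some (l.drop n) := by
    intro n
    induction n with
    | zero => exact hl
    | succ n ih =>
      have h1 : (p (n + 1)).2 i = residualPath ((p n).2 i) (p (n + 1)).1 := by rw [hp]
      rw [h1, ih]
      rcases lt_or_ge n l.length with hn | hn
      · rw [List.drop_eq_getElem_cons hn]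
        simp only [residualPath]
        rw [if_pos]
        simpa using hω.2 n hn
      · rw [List.drop_eq_nil_of_le hn, List.drop_eq_nil_of_le (hn.trans (Nat.le_succ n))]
        rfl
  refine (hlt l.length).not_ge ((le_of_eq ?_).trans (ENNReal.le_tsum i))
  simp [hdrop, residualProb, chainPathProb]

theorem exists_residualProb_le_chainFun_add (k : S → S → ℝ≥0∞) (s : S) (A : Set (ℕ → S))
    (hA : chainFun k s A ≠ ⊤) {δ : ℝ≥0∞} (hδ : 0 < δ) :
    ∃ o : Option (List S), residualProb k s o ≤ chainFun k s A + δ ∧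
      ∀ ω ∈ A, ∃ l, o = some l ∧ ω ∈ chainCyl s l := by
  rcases eq_or_ne A ∅ with rfl | hne
  · exact ⟨none, zero_le, fun ω hω => hω.elim⟩
  · have hlt : chainFun k s A < chainFun k s A + δ := ENNReal.lt_add_right hA hδ.ne'
    conv_lhs at hlt => rw [chainFun, if_neg hne]
    obtain ⟨l, hl⟩ := iInf_lt_iff.1 hlt
    obtain ⟨rfl, hl⟩ := iInf_lt_iff.1 hl
    exact ⟨some l, hl.le, fun ω hω => ⟨l, rfl, hω⟩⟩

theorem one_le_chainPr_univ (k : S → S → ℝ≥0∞) (hk : ∀ a, ∑' b, k a b = 1) (s : S) :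
    1 ≤ chainPr k s Set.univ := by
  rw [chainPr, MeasureTheory.OuterMeasure.ofFunction_apply]
  refine le_iInf₂ fun t ht => ?_
  by_contra! hlt
  have hfin : ∀ n, chainFun k s (t n) ≠ ⊤ := ENNReal.ne_top_of_tsum_ne_top hlt.ne_top
  obtain ⟨δ, hδ, hsum⟩ :=
    ENNReal.exists_pos_sum_of_countable' (tsub_pos_of_lt hlt).ne' ℕ
  choose L hL hcov using fun n =>
    exists_residualProb_le_chainFun_add k s (t n) (hfin n) (hδ n)
  obtain ⟨ω, h0, hω⟩ := exists_trajectory_notMem_chainCyl k hk s L <| calc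
    ∑' n, residualProb k s (L n) ≤ ∑' n, (chainFun k s (t n) + δ n) := ENNReal.tsum_le_tsum hL
    _ = ∑' n, chainFun k s (t n) + ∑' n, δ n := ENNReal.tsum_add
    _ < 1 := by
      rw [add_comm]
      exact lt_tsub_iff_right.1 hsum
  obtain ⟨n, hn⟩ := Set.mem_iUnion.1 (ht ⟨Set.mem_univ ω, h0⟩)
  obtain ⟨l, hl, hmem⟩ := hcov n ω hn
  exact hω n l hl hmem

/-- A geometric drift condition forces the chain to leave `bad`. -/
theorem chainPr_evAlways_eq_zero [Countable S] (k : S → S → ℝ≥0∞) (hk : ∀ a, ∑' b, k a b = 1)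
    (bad : S → Prop) (h : S → ℝ≥0∞) (hone : ∀ a, 1 ≤ h a) (htop : ∀ a, h a ≠ ⊤)
    (c : ℝ≥0∞) (hc : c < 1)
    (hdrift : ∀ a, ∑' b, k a b * (if bad b then h b else 0) ≤ c * h a) (s : S) :
    chainPr k s (evAlways bad) = 0 := by
  have hfin : ∀ a b, k a b ≠ ⊤ := fun a =>
    ENNReal.ne_top_of_tsum_ne_top (by simp [hk])
  have hgood : ∀ a, ¬ bad a → chainPr k a (evAlways bad) = 0 := by
    intro a ha
    have : evAlways bad ∩ {ω | ω 0 = a} = ∅ := by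
      ext ω
      simp only [Set.mem_inter_iff, Set.mem_ofPred_eq, Set.mem_empty_iff_false, iff_false, not_and]
      rintro hω rfl
      exact ha (hω 0)
    rw [chainPr, this]
    exact MeasureTheory.measure_empty
  have hpow : ∀ (n : ℕ) a, chainPr k a (evAlways bad) ≤ c ^ n * h a := by
    intro n
    induction n with
    | zero => intro a; simpa using (chainPr_le_one k a _).trans (hone a)
    | succ n ih =>
      intro a
      calc chainPr k a (evAlways bad)
          ≤ ∑' b, k a b * chainPr k b {ω | prependState a ω ∈ evAlways bad} :=
            chainPr_le_tsum k a (hfin a) _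
        _ ≤ ∑' b, c ^ n * (k a b * (if bad b then h b else 0)) := by
            refine ENNReal.tsum_le_tsum fun b => ?_
            rw [mul_left_comm]
            gcongr
            refine (chainPr_mono k b 
              (E := {ω | prependState a ω ∈ evAlways bad}) (F := evAlways bad)
              fun ω hω i => hω (i + 1)).trans ?_
            split_ifs with hb
            · exact ih b
            · rw [hgood b hb]
              exact zero_le
        _ = c ^ n * ∑' b, k a b * (if bad b then h b else 0) := ENNReal.tsum_mul_left
        _ ≤ c ^ n * (c * h a) := by
            gcongr
            exact hdrift a
        _ = c ^ (n + 1) * h a := by ring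
  have hlim : Filter.Tendsto (fun n : ℕ => c ^ n * h s) Filter.atTop (nhds 0) := by
    simpa using ENNReal.Tendsto.mul_const
      (ENNReal.tendsto_pow_atTop_nhds_zero_of_lt_one hc) (Or.inr (htop s))
  exact le_antisymm (ge_of_tendsto' hlim fun n => hpow n s) zero_le

theorem chainPr_forall_ge_eq_zero [Countable S] (k : S → S → ℝ≥0∞) (hk : ∀ a, ∑' b, k a b = 1)
    (bad : S → Prop) (hbad : ∀ a, chainPr k a (evAlways bad) = 0) (n : ℕ) (s : S) :
    chainPr k s {ω | ∀ i, n ≤ i → bad (ω i)} = 0 := by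
  induction n generalizing s with
  | zero => simpa [evAlways] using hbad s
  | succ n ih =>
    refine le_antisymm ((chainPr_le_tsum k s
      (ENNReal.ne_top_of_tsum_ne_top (by simp [hk])) _).trans ?_) zero_le
    refine le_of_eq (ENNReal.tsum_eq_zero.2 fun b => mul_eq_zero_of_right _ ?_)
    refine le_antisymm ((chainPr_mono k b (E := {ω | ∀ i, n + 1 ≤ i → bad (prependState s ω i)})
      (F := {ω | ∀ i, n ≤ i → bad (ω i)})
      fun ω hω i hi => hω (i + 1) (Nat.succ_le_succ hi)).trans (ih b).le) zero_le

theorem chainPr_evInfOften_eq_one [Countable S] (k : S → S → ℝ≥0∞) (hk : ∀ a, ∑' b, k a b = 1)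
    (P : S → Prop) (hP : ∀ a, chainPr k a (evAlways fun b => ¬ P b) = 0) (s : S) :
    chainPr k s (evInfOften P) = 1 := by
  refine le_antisymm (chainPr_le_one k s _) ((one_le_chainPr_univ k hk s).trans ?_)
  have hsub : Set.univ ∩ {ω : ℕ → S | ω 0 = s} ⊆ (evInfOften P ∩ {ω | ω 0 = s}) ∪
      ⋃ n : ℕ, ({ω | ∀ i, n ≤ i → ¬ P (ω i)} ∩ {ω | ω 0 = s}) := by
    rintro ω ⟨-, h0⟩
    by_cases hω : ω ∈ evInfOften P
    · exact Or.inl ⟨hω, h0⟩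
    · simp only [evInfOften, Set.mem_ofPred_eq, not_forall, not_exists, not_and] at hω
      obtain ⟨n, hn⟩ := hω
      exact Or.inr (Set.mem_iUnion.2 ⟨n, hn, h0⟩)
  refine (MeasureTheory.measure_mono hsub).trans ((MeasureTheory.measure_union_le _ _).trans ?_)
  have hzero : MeasureTheory.OuterMeasure.ofFunction (chainFun k s) (chainFun_empty k s)
      (⋃ n : ℕ, ({ω | ∀ i, n ≤ i → ¬ P (ω i)} ∩ {ω | ω 0 = s})) = 0 :=
    MeasureTheory.measure_iUnion_null fun n => chainPr_forall_ge_eq_zero k hk _ hP n s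
  rw [hzero, add_zero]
  rfl

end ChainFacts

/-! ## Message losses -/

section Losses

theorem countEmb_eq_count {M : Type} [DecidableEq M] (v w : List M) :
    countEmb v w = v.sublists'.count w := by
  induction v generalizing w with
  | nil => cases w <;> simp [countEmb]
  | cons a v ih =>
    rw [List.sublists'_cons, List.count_append]
    cases w with
    | nil =>
      rw [List.count_eq_zero_of_not_mem (l := List.map _ _) (by simp), add_zero, ← ih]
      cases v <;> simp [countEmb]
    | cons b w =>
      rw [countEmb, ih, ih, add_comm]
      congr 1
      split_ifs with h
      · subst h
        exact (List.count_map_of_injective _ _ List.cons_injective _).symm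
      · refine (List.count_eq_zero_of_not_mem ?_).symm
        simp [h]

theorem sum_map_sublists' {M : Type} (x y : ℝ) (v : List M) :
    (v.sublists'.map fun w => x ^ w.length * y ^ (v.length - w.length)).sum =
      (x + y) ^ v.length := by
  induction v with
  | nil => simp
  | cons a v ih =>
    rw [List.sublists'_cons, List.map_append, List.sum_append, List.map_map]
    have h1 : (v.sublists'.map fun w => x ^ w.length * y ^ ((a :: v).length - w.length)) =
        v.sublists'.map fun w => y * (x ^ w.length * y ^ (v.length - w.length)) := by
      refine List.map_congr_left fun w hw => ?_
      have := (List.mem_sublists'.1 hw).length_le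
      rw [List.length_cons, Nat.succ_sub this, pow_succ]
      ring
    have h2 : (v.sublists'.map
        ((fun w => x ^ w.length * y ^ ((a :: v).length - w.length)) ∘ List.cons a)) =
        v.sublists'.map fun w => x * (x ^ w.length * y ^ (v.length - w.length)) := by
      refine List.map_congr_left fun w _ => ?_
      simp only [Function.comp_apply, List.length_cons, Nat.add_sub_add_right, pow_succ]
      ring
    rw [h1, h2, List.sum_map_mul_left, List.sum_map_mul_left, ih, List.length_cons, pow_succ]
    ring

theorem sum_sublists_countEmb {M : Type} [DecidableEq M] (x y : ℝ) (v : List M) :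
    ∑ w ∈ v.sublists'.toFinset, x ^ w.length * y ^ (v.length - w.length) * countEmb v w =
      (x + y) ^ v.length := by
  rw [← sum_map_sublists', Finset.sum_list_map_count]
  refine Finset.sum_congr rfl fun w _ => ?_
  rw [countEmb_eq_count, nsmul_eq_mul, mul_comm]
  congr!

variable {C M : Type} [Fintype C] [DecidableEq C] [DecidableEq M]

/-- The channel contents obtainable from `v` through message losses. -/
def subChans (v : Chans C M) : Finset (Chans C M) :=
  Fintype.piFinset fun c => (v c).sublists'.toFinset

theorem mem_subChans {v w : Chans C M} :
    w ∈ subChans v ↔ ∀ c, List.Sublist (w c) (v c) := by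
  simp [subChans]

/-- The real number whose image in `ℝ≥0∞` is `plost τ v w`. -/
noncomputable def lossWeight (τ : ℝ) (v w : Chans C M) : ℝ :=
  τ ^ (chansSize v - chansSize w) * (1 - τ) ^ chansSize w * (∏ c, countEmb (v c) (w c) : ℕ)

omit [DecidableEq C] in
theorem lossWeight_nonneg {τ : ℝ} (h0 : 0 ≤ τ) (h1 : τ ≤ 1) (v w : Chans C M) :
    0 ≤ lossWeight τ v w := by
  have : 0 ≤ 1 - τ := by linarith
  unfold lossWeight
  positivity

theorem plost_eq_zero {v w : Chans C M} (hw : w ∉ subChans v) (τ : ℝ) : plost τ v w = 0 := by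
  simp only [mem_subChans, not_forall] at hw
  obtain ⟨c, hc⟩ := hw
  have : ∏ c, countEmb (v c) (w c) = 0 :=
    Finset.prod_eq_zero (Finset.mem_univ c) (by
      rw [countEmb_eq_count, List.count_eq_zero_of_not_mem]
      rwa [List.mem_sublists'])
  simp [plost, this]

theorem chansSize_sub {v w : Chans C M} (hw : w ∈ subChans v) :
    chansSize v - chansSize w = ∑ c, ((v c).length - (w c).length) :=
  (Finset.sum_tsub_distrib _ fun c _ => (mem_subChans.1 hw c).length_le).symm

/-- The generating function of the number of messages that survive the losses. -/
theorem sum_lossWeight_mul_pow (τ z : ℝ) (v : Chans C M) :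
    ∑ w ∈ subChans v, lossWeight τ v w * z ^ chansSize w = (z * (1 - τ) + τ) ^ chansSize v := by
  have h : ∀ w ∈ subChans v, lossWeight τ v w * z ^ chansSize w =
      ∏ c, ((z * (1 - τ)) ^ (w c).length * τ ^ ((v c).length - (w c).length) *
        countEmb (v c) (w c)) := by
    intro w hw
    rw [lossWeight, chansSize_sub hw, Finset.prod_mul_distrib, Finset.prod_mul_distrib,
      Finset.prod_pow_eq_pow_sum, Finset.prod_pow_eq_pow_sum, mul_pow, Nat.cast_prod]
    simp only [chansSize]
    ring
  rw [Finset.sum_congr rfl h, subChans, ← Finset.prod_univ_sum (fun c => (v c).sublists'.toFinset)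
    fun c u => (z * (1 - τ)) ^ u.length * τ ^ ((v c).length - u.length) * countEmb (v c) u]
  simp only [sum_sublists_countEmb, Finset.prod_pow_eq_pow_sum, chansSize]

theorem sum_lossWeight (τ : ℝ) (v : Chans C M) : ∑ w ∈ subChans v, lossWeight τ v w = 1 := by
  simpa using sum_lossWeight_mul_pow τ 1 v

omit [DecidableEq C] in
theorem lossWeight_eps (τ : ℝ) (v : Chans C M) : lossWeight τ v (eps C M) = τ ^ chansSize v := by
  have h : ∀ u : List M, countEmb u [] = 1 := fun u => by cases u <;> rfl
  simp [lossWeight, chansSize, eps, h]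

theorem eps_mem_subChans (v : Chans C M) : eps C M ∈ subChans v :=
  mem_subChans.2 fun _ => List.nil_sublist _

omit [DecidableEq M] in
theorem chansSize_update (v : Chans C M) (c : C) (u : List M) (h : u.length ≤ (v c).length + 1) :
    chansSize (Function.update v c u) ≤ chansSize v + 1 := by
  unfold chansSize
  rw [← Finset.add_sum_erase _ _ (Finset.mem_univ c),
    ← Finset.add_sum_erase (a := c) _ (fun c => (v c).length) (Finset.mem_univ c),
    Finset.sum_congr rfl fun d hd => by rw [Function.update_of_ne (Finset.ne_of_mem_erase hd)]]
  simp only [Function.update_self]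
  omega

omit [DecidableEq M] in
theorem chansSize_applyOp_le (o : LcsOp C M) (v : Chans C M) :
    chansSize (applyOp o v) ≤ chansSize v + 1 := by
  cases o with
  | send c m => exact chansSize_update v c _ (by simp)
  | recv c m => exact chansSize_update v c _ (by simp; omega)
  | internal => exact Nat.le_succ _

theorem tsum_plost_mul {τ : ℝ} (h0 : 0 ≤ τ) (h1 : τ ≤ 1) (v : Chans C M) {f : Chans C M → ℝ}
    (hf : ∀ w, 0 ≤ f w) :
    ∑' w, plost τ v w * ENNReal.ofReal (f w) =
      ENNReal.ofReal (∑ w ∈ subChans v, lossWeight τ v w * f w) := by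
  rw [tsum_eq_sum (s := subChans v) fun w hw => by rw [plost_eq_zero hw, zero_mul],
    ENNReal.ofReal_sum_of_nonneg fun w _ => mul_nonneg (lossWeight_nonneg h0 h1 v w) (hf w)]
  exact Finset.sum_congr rfl fun w _ => (ENNReal.ofReal_mul (lossWeight_nonneg h0 h1 v w)).symm

theorem tsum_plost {τ : ℝ} (h0 : 0 ≤ τ) (h1 : τ ≤ 1) (v : Chans C M) :
    ∑' w, plost τ v w = 1 := by
  simpa [sum_lossWeight] using tsum_plost_mul h0 h1 v (f := fun _ => 1) fun _ => zero_le_one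

/-- Constants of the drift condition for the number of messages in the channels. -/
theorem exists_drift_constants {τ : ℝ} (h0 : 0 < τ) (h1 : τ < 1) :
    ∃ D c : ℝ, 0 ≤ D ∧ 0 ≤ c ∧ c < 1 ∧ ∀ n : ℕ,
      (2 - τ) ^ (n + 1) + D * (1 - τ ^ (n + 1)) ≤ c * (2 ^ n + D) := by
  obtain ⟨m, hm⟩ := exists_pow_lt_of_lt_one (show (0 : ℝ) < 1 / 8 by norm_num)
    (show (2 - τ) / 2 < 1 by linarith)
  have htm : 0 < τ ^ (m + 1) := by positivity
  have htm1 : τ ^ (m + 1) ≤ 1 := pow_le_one₀ h0.le h1.le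
  set t := τ ^ (m + 1) with ht
  set B : ℝ := 2 ^ (m + 1) with hB
  have hB1 : 1 ≤ B := one_le_pow₀ (by norm_num)
  set D := 2 * B / t with hD
  have hDt : D * t = 2 * B := by rw [hD]; field_simp
  have hDpos : 0 < D := by positivity
  set ε := t / (8 * B) with hε
  have hεB : ε * B = t / 8 := by rw [hε]; field_simp
  have hεpos : 0 < ε := by positivity
  have hεle : ε ≤ 1 / 8 := by
    rw [hε, div_le_div_iff₀ (by positivity) (by norm_num)]
    nlinarith
  have hDε : D * ε = 1 / 4 := by rw [hD, hε]; field_simp; norm_num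
  refine ⟨D, 1 - ε, hDpos.le, by linarith, by linarith, fun n => ?_⟩
  have h2n : (1 : ℝ) ≤ 2 ^ n := one_le_pow₀ (by norm_num)
  have hτn : 0 ≤ τ ^ (n + 1) := by positivity
  rcases le_or_gt m n with hn | hn
  · have hpow : (2 - τ) ^ n ≤ 1 / 8 * 2 ^ n := by
      rw [← div_le_iff₀ (by positivity), ← div_pow]
      exact (pow_le_pow_of_le_one (by linarith) (by linarith) hn).trans hm.le
    have hpow' : (2 - τ) ^ (n + 1) ≤ 1 / 4 * 2 ^ n := by
      rw [pow_succ]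
      nlinarith [show (0 : ℝ) ≤ (2 - τ) ^ n from pow_nonneg (by linarith) n]
    nlinarith
  · have hpow : (2 - τ) ^ (n + 1) ≤ B :=
      (pow_le_pow_left₀ (by linarith) (by linarith) _).trans
        (pow_le_pow_right₀ (by norm_num) (by omega))
    have hτ : t ≤ τ ^ (n + 1) := pow_le_pow_of_le_one h0.le h1.le (by omega)
    nlinarith [mul_le_mul_of_nonneg_left hτ hDpos.le]

/-- One lossy step decreases the potential `2 ^ size + D` on nonempty contents. -/
theorem sum_lossWeight_drift {τ D c : ℝ} (h0 : 0 < τ) (h1 : τ < 1) (hD : 0 ≤ D)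
    (hc : ∀ n : ℕ, (2 - τ) ^ (n + 1) + D * (1 - τ ^ (n + 1)) ≤ c * (2 ^ n + D))
    {v : Chans C M} {n : ℕ} (hv : chansSize v ≤ n + 1) :
    ∑ w ∈ subChans v, lossWeight τ v w * (if w = eps C M then 0 else 2 ^ chansSize w + D) ≤
      c * (2 ^ n + D) := by
  refine le_trans ?_ (hc n)
  calc _ ≤ ∑ w ∈ subChans v, (lossWeight τ v w * 2 ^ chansSize w +
          D * (lossWeight τ v w - if w = eps C M then lossWeight τ v w else 0)) := by
        refine Finset.sum_le_sum fun w _ => ?_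
        have := lossWeight_nonneg h0.le h1.le v w
        split_ifs
        · simp only [mul_zero, sub_self, add_zero]
          positivity
        · exact le_of_eq (by ring)
    _ = (2 - τ) ^ chansSize v + D * (1 - τ ^ chansSize v) := by
        rw [Finset.sum_add_distrib, ← Finset.mul_sum, Finset.sum_sub_distrib,
          sum_lossWeight_mul_pow, sum_lossWeight, Finset.sum_ite_eq' (subChans v) (eps C M),
          if_pos (eps_mem_subChans v), lossWeight_eps]
        ring_nf
    _ ≤ (2 - τ) ^ (n + 1) + D * (1 - τ ^ (n + 1)) := by
        gcongr ?_ + D * (1 - ?_)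
        · exact pow_le_pow_right₀ (by linarith) hv
        · exact pow_le_pow_of_le_one h0.le h1.le hv

end Losses

/-! ## The chain induced by a scheduler -/

section SchedulerChain
variable {Q C M : Type} [Fintype C] [DecidableEq C] [DecidableEq M] {N : NPLCS Q C M}

theorem Scheduler.tsum_kernel_mul (U : Scheduler N) (a : List (Conf Q C M) × Conf Q C M)
    (f : Chans C M → ℝ≥0∞) :
    ∑' b, U.kernel a b * f b.2.2 =
      ∑' w, plost N.τ (applyOp (U.choose a.1 a.2).op a.2.2) w * f w := by
  set δ := U.choose a.1 a.2 with hδ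
  let g : Chans C M → List (Conf Q C M) × Conf Q C M := fun w => (a.1 ++ [a.2], (δ.dst, w))
  have hg : Function.Injective g := fun w w' h => by simpa [g] using h
  rw [← hg.tsum_eq]
  · refine tsum_congr fun w => ?_
    simp [g, Scheduler.kernel, NPLCS.stepProb, ← hδ, hδ ▸ U.choose_mem a.1 a.2,
      hδ ▸ U.choose_enabled a.1 a.2]
  · rintro ⟨h, q, w⟩ hb
    by_contra hne
    refine hb ?_
    have : U.kernel a (h, q, w) = 0 := by
      unfold Scheduler.kernel NPLCS.stepProb
      split_ifs with h1 h2
      · refine absurd ⟨w, ?_⟩ hne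
        simp_all [g]
      · rfl
      · rfl
    simp [this]

theorem Scheduler.tsum_kernel (U : Scheduler N) (a : List (Conf Q C M) × Conf Q C M) :
    ∑' b, U.kernel a b = 1 := by
  simpa [tsum_plost N.τ_pos.le N.τ_lt_one.le] using U.tsum_kernel_mul a fun _ => 1

theorem Scheduler.chainPr_evAlways_ne_eps [Countable Q] [Countable M] (U : Scheduler N)
    (a : List (Conf Q C M) × Conf Q C M) :
    chainPr U.kernel a (evAlways fun b => ¬ b.2.2 = eps C M) = 0 := by
  obtain ⟨D, c, hD, hc0, hc1, hdrift⟩ := exists_drift_constants N.τ_pos N.τ_lt_one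
  refine chainPr_evAlways_eq_zero U.kernel U.tsum_kernel _
    (fun b => ENNReal.ofReal (2 ^ chansSize b.2.2 + D)) (fun b => ?_)
    (fun b => ENNReal.ofReal_ne_top) (ENNReal.ofReal c) (by simpa using hc1) (fun b => ?_) a
  · rw [ENNReal.one_le_ofReal]
    have : (1 : ℝ) ≤ 2 ^ chansSize b.2.2 := one_le_pow₀ (by norm_num)
    linarith
  · have h := U.tsum_kernel_mul b fun w =>
      ENNReal.ofReal (if w = eps C M then 0 else 2 ^ chansSize w + D)
    rw [tsum_plost_mul N.τ_pos.le N.τ_lt_one.le _ fun w => by split_ifs <;> positivity] at h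
    rw [← ENNReal.ofReal_mul hc0]
    refine le_trans (le_of_eq ?_) (h.le.trans (ENNReal.ofReal_le_ofReal
      (sum_lossWeight_drift N.τ_pos N.τ_lt_one hD hdrift (chansSize_applyOp_le _ _))))
    refine tsum_congr fun b' => ?_
    by_cases hb : b'.2.2 = eps C M <;> simp [hb]

end SchedulerChain

/-- Finite-attractor property: under any scheduler, from any starting
configuration, almost surely configurations with all channels empty are
visited infinitely often. -/
theorem statement0 {Q C M : Type} [Fintype Q] [Fintype C] [DecidableEq C]
    [Fintype M] [DecidableEq M] (N : NPLCS Q C M) (U : Scheduler N)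
    (s : Conf Q C M) :
    U.Pr s (evInfOften (fun t : Conf Q C M => t.2 = eps C M)) = 1 := by
  exact chainPr_evInfOften_eq_one U.kernel U.tsum_kernel (fun b => b.2.2 = eps C M)
    U.chainPr_evAlways_ne_eps ([], s)

end NPLCSmodel
end

section
/- For every NPLCS N, every set of locations A ⊆ Q and every location x ∈ Q: if Pr_U((x,ε) ⊨ □A) = 1 for some scheduler U, then x ∈ Safe(A). -/
open scoped ENNReal
open Classical

namespace NPLCSmodel

variable {Q C M : Type}

variable [DecidableEq C]

variable [Fintype C] [DecidableEq M]

variable {N : NPLCS Q C M}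

/-! ## Substochastic chains -/

section Chain
variable {S : Type}

theorem tsum_chainPathProb_le_one {k : S → S → ℝ≥0∞} (hk : ∀ s, ∑' t, k s t ≤ 1) (n : ℕ) (s : S) :
    ∑' g : Fin n → S, chainPathProb k s (List.ofFn g) ≤ 1 := by
  induction n generalizing s with
  | zero => simp [chainPathProb, tsum_fintype]
  | succ n ih =>
    rw [← (Fin.consEquiv (fun _ : Fin (n + 1) => S)).tsum_eq, ENNReal.tsum_prod']
    refine le_trans (ENNReal.tsum_le_tsum fun a => ?_) (hk s)
    have hcons (g : Fin n → S) :
        chainPathProb k s (List.ofFn (Fin.consEquiv (fun _ : Fin (n + 1) => S) (a, g))) =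
          k s a * chainPathProb k a (List.ofFn g) := by
      simp [List.ofFn_succ, chainPathProb, Fin.consEquiv]
    simp_rw [hcons, ENNReal.tsum_mul_left]
    exact mul_le_of_le_one_right' (ih a)

theorem chainPathProb_ofFn_ne_zero {k : S → S → ℝ≥0∞} {ω : ℕ → S}
    (hω : ∀ i, k (ω i) (ω (i + 1)) ≠ 0) (n : ℕ) :
    chainPathProb k (ω 0) (List.ofFn fun i : Fin n => ω (i + 1)) ≠ 0 := by
  induction n generalizing ω with
  | zero => simp [chainPathProb]
  | succ n ih =>
    simp only [List.ofFn_succ, chainPathProb]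
    refine mul_ne_zero (hω 0) ?_
    simpa using ih (ω := fun i => ω (i + 1)) fun i => hω (i + 1)

theorem mem_chainCyl_ofFn {s : S} {n : ℕ} {g : Fin n → S} {ω : ℕ → S} :
    ω ∈ chainCyl s (List.ofFn g) ↔ ω 0 = s ∧ ∀ i : Fin n, ω (i + 1) = g i := by
  simp [chainCyl, Fin.forall_iff]

/-- An almost sure event of a substochastic chain contains a trajectory following any finite
prefix of positive probability. -/
theorem exists_mem_of_chainPr_eq_one [Countable S] {k : S → S → ℝ≥0∞}
    (hk : ∀ s, ∑' t, k s t ≤ 1) {ω₀ : ℕ → S} (hω₀ : ∀ i, k (ω₀ i) (ω₀ (i + 1)) ≠ 0)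
    {E : Set (ℕ → S)} (hE : chainPr k (ω₀ 0) E = 1) (n : ℕ) :
    ∃ ω ∈ E, ω 0 = ω₀ 0 ∧ ∀ i < n, ω (i + 1) = ω₀ (i + 1) := by
  by_contra! hcon
  set s := ω₀ 0
  set g₀ : Fin n → S := fun i => ω₀ (i + 1)
  let cyl : (Fin n → S) → Set (ℕ → S) := fun g =>
    if g = g₀ then ∅ else chainCyl s (List.ofFn g)
  let cost : (Fin n → S) → ℝ≥0∞ := fun g =>
    if g = g₀ then 0 else chainPathProb k s (List.ofFn g)
  have hcover : E ∩ {ω | ω 0 = s} ⊆ ⋃ g, cyl g := by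
    rintro ω ⟨hωE, hω0⟩
    obtain ⟨i, hi, hne⟩ := hcon ω hωE hω0
    refine Set.mem_iUnion.2 ⟨fun i => ω (i + 1), ?_⟩
    have hg : (fun i : Fin n => ω (i + 1)) ≠ g₀ := fun h => hne (congrFun h ⟨i, hi⟩)
    simp only [cyl, if_neg hg]
    exact mem_chainCyl_ofFn.2 ⟨hω0, fun _ => rfl⟩
  have hle : (1 : ℝ≥0∞) ≤ ∑' g, cost g := by
    rw [← hE, chainPr]
    refine (MeasureTheory.measure_mono hcover).trans
      ((MeasureTheory.measure_iUnion_le _).trans (ENNReal.tsum_le_tsum fun g => ?_))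
    refine (MeasureTheory.OuterMeasure.ofFunction_le _).trans ?_
    simp only [cyl, cost]
    split_ifs
    · exact (chainFun_empty k s).le
    · exact chainFun_chainCyl_le k s _
  have htot : chainPathProb k s (List.ofFn g₀) + ∑' g, cost g ≤ 1 := by
    refine le_of_eq_of_le ?_ (tsum_chainPathProb_le_one hk n s)
    rw [ENNReal.tsum_eq_add_tsum_ite (f := fun g => chainPathProb k s (List.ofFn g)) g₀]
    congr! 3 with g
    simp only [cost]
    congr
  have hfin : ∑' g, cost g ≠ ∞ := ne_top_of_le_ne_top ENNReal.one_ne_top (le_add_self.trans htot)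
  have hlt := ENNReal.lt_add_right hfin (chainPathProb_ofFn_ne_zero hω₀ n)
  rw [add_comm] at hlt
  exact absurd (hle.trans_lt hlt) htot.not_gt

end Chain

/-! ## The message-loss distribution -/

/-- The probability that the single-channel content `v` becomes `w` through message losses. -/
noncomputable def wordLost {M : Type} [DecidableEq M] (τ : ℝ) (v w : List M) : ℝ≥0∞ :=
  ENNReal.ofReal (τ ^ (v.length - w.length) * (1 - τ) ^ w.length * countEmb v w)

section Loss
variable {C M : Type} [DecidableEq M] {τ : ℝ}

theorem countEmb_nil_right (v : List M) : countEmb v [] = 1 := by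
  cases v <;> simp [countEmb]

theorem countEmb_eq_zero_of_length_lt {v w : List M} (h : v.length < w.length) :
    countEmb v w = 0 := by
  induction v generalizing w with
  | nil => cases w <;> simp_all [countEmb]
  | cons a v ih =>
    cases w with
    | nil => simp at h
    | cons b w =>
      simp only [List.length_cons] at h
      rw [countEmb, ih (w := w) (by omega), ih (w := b :: w) (by simp; omega)]
      simp

theorem wordLost_cons_nil (hτ : 0 ≤ τ) (a : M) (v : List M) :
    wordLost τ (a :: v) [] = ENNReal.ofReal τ * wordLost τ v [] := by
  rw [wordLost, wordLost, ← ENNReal.ofReal_mul hτ]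
  simp [countEmb_nil_right, pow_succ']

theorem wordLost_cons_cons (hτ : 0 ≤ τ) (hτ' : τ ≤ 1) (a b : M) (v w : List M) :
    wordLost τ (a :: v) (b :: w) = ENNReal.ofReal τ * wordLost τ v (b :: w) +
      if a = b then ENNReal.ofReal (1 - τ) * wordLost τ v w else 0 := by
  have h1 : 0 ≤ 1 - τ := sub_nonneg.2 hτ'
  have hkeep : τ ^ (v.length - w.length) * (1 - τ) ^ (w.length + 1) * (countEmb v (b :: w) : ℝ) =
      τ * (τ ^ (v.length - (w.length + 1)) * (1 - τ) ^ (w.length + 1) * countEmb v (b :: w)) := by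
    by_cases h : v.length < w.length + 1
    · rw [countEmb_eq_zero_of_length_lt (by simpa using h)]
      simp
    · rw [show v.length - w.length = (v.length - (w.length + 1)) + 1 by omega, pow_succ' τ]
      ring
  unfold wordLost
  rw [← ENNReal.ofReal_mul hτ, ← ENNReal.ofReal_mul h1]
  simp only [List.length_cons, Nat.add_sub_add_right, countEmb]
  split_ifs
  · rw [← ENNReal.ofReal_add (by positivity) (by positivity), ← hkeep]
    push_cast
    congr 1
    ring
  · rw [← hkeep]
    simp

theorem tsum_wordLost (hτ : 0 ≤ τ) (hτ' : τ ≤ 1) (v : List M) : ∑' w, wordLost τ v w = 1 := by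
  induction v with
  | nil =>
    rw [tsum_eq_single []]
    · simp [wordLost, countEmb_nil_right]
    · intro w hw
      rw [wordLost, countEmb_eq_zero_of_length_lt (by simpa [List.length_pos_iff] using hw)]
      simp
  | cons a v ih =>
    let keep : List M → ℝ≥0∞ := fun w => match w with
      | [] => 0
      | b :: w => if a = b then ENNReal.ofReal (1 - τ) * wordLost τ v w else 0
    have hsplit : ∀ w, wordLost τ (a :: v) w = ENNReal.ofReal τ * wordLost τ v w + keep w := by
      rintro (_ | ⟨b, w⟩)
      · simp [keep, wordLost_cons_nil hτ]
      · exact wordLost_cons_cons hτ hτ' a b v w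
    have hkeep : ∑' w, keep w = ENNReal.ofReal (1 - τ) := by
      rw [← (List.cons_injective (a := a)).tsum_eq]
      · simp [keep, ENNReal.tsum_mul_left, ih]
      · rintro (_ | ⟨b, w⟩) hw
        · simp [keep] at hw
        · have : a = b := by
            by_contra hab
            simp [keep, hab] at hw
          exact ⟨w, by rw [this]⟩
    simp_rw [hsplit]
    rw [ENNReal.tsum_add, ENNReal.tsum_mul_left, ih, hkeep, mul_one,
      ← ENNReal.ofReal_add hτ (sub_nonneg.2 hτ')]
    simp

theorem plost_eq_prod_wordLost [DecidableEq C] [Fintype C] (hτ : 0 ≤ τ) (hτ' : τ ≤ 1)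
    (v w : Chans C M) : plost τ v w = ∏ c, wordLost τ (v c) (w c) := by
  have h1 : 0 ≤ 1 - τ := sub_nonneg.2 hτ'
  unfold plost wordLost
  rw [← ENNReal.ofReal_prod_of_nonneg fun c _ => by positivity]
  congr 1
  rw [Finset.prod_mul_distrib, Finset.prod_mul_distrib, Finset.prod_pow_eq_pow_sum,
    Finset.prod_pow_eq_pow_sum]
  push_cast
  by_cases hlen : ∀ c, (w c).length ≤ (v c).length
  · rw [Finset.sum_tsub_distrib _ fun c _ => hlen c]
    rfl
  · push Not at hlen
    obtain ⟨c, hc⟩ := hlen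
    have hzero : ∏ c, (countEmb (v c) (w c) : ℝ) = 0 :=
      Finset.prod_eq_zero (Finset.mem_univ c) (by simp [countEmb_eq_zero_of_length_lt hc])
    rw [hzero, mul_zero, mul_zero]

theorem tsum_plost_le_one [DecidableEq C] [Fintype C] (hτ : 0 ≤ τ) (hτ' : τ ≤ 1)
    (v : Chans C M) : ∑' w, plost τ v w ≤ 1 := by
  simp_rw [plost_eq_prod_wordLost hτ hτ']
  rw [ENNReal.tsum_eq_iSup_sum]
  refine iSup_le fun F => ?_
  let T : C → Finset (List M) := fun c => F.image fun w => w c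
  calc ∑ w ∈ F, ∏ c, wordLost τ (v c) (w c)
      ≤ ∑ w ∈ Fintype.piFinset T, ∏ c, wordLost τ (v c) (w c) :=
        Finset.sum_le_sum_of_subset fun w hw =>
          Fintype.mem_piFinset.2 fun c => Finset.mem_image_of_mem (fun w => w c) hw
    _ = ∏ c, ∑ u ∈ T c, wordLost τ (v c) u := (Finset.prod_univ_sum T _).symm
    _ ≤ 1 := Finset.prod_le_one' fun c _ =>
        (ENNReal.sum_le_tsum _).trans (tsum_wordLost hτ hτ' _).le

theorem plost_eps_ne_zero [DecidableEq C] [Fintype C] (hτ : 0 < τ) (v : Chans C M) :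
    plost τ v (eps C M) ≠ 0 := by
  have : 0 < τ ^ chansSize v := pow_pos hτ _
  simpa [plost, chansSize, eps, countEmb_nil_right] using this

end Loss

/-! ## The Markov chain of a scheduler -/

namespace Scheduler
variable {Q C M : Type} [DecidableEq C] [Fintype C] [DecidableEq M] {N : NPLCS Q C M}

theorem tsum_kernel_le_one (U : Scheduler N) (a : List (Conf Q C M) × Conf Q C M) :
    ∑' b, U.kernel a b ≤ 1 := by
  let f : Chans C M → List (Conf Q C M) × Conf Q C M := fun w =>
    (a.1 ++ [a.2], (U.choose a.1 a.2).dst, w)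
  have hf : Function.Injective f := fun w w' h => by simpa [f] using h
  have hsupp : Function.support (U.kernel a) ⊆ Set.range f := by
    rintro ⟨h, q, w⟩ hb
    simp only [Function.mem_support, kernel, NPLCS.stepProb] at hb
    split_ifs at hb with h1 h2
    · obtain ⟨-, -, rfl⟩ := h2
      exact ⟨w, by simp [f, h1]⟩
    · exact absurd rfl hb
    · exact absurd rfl hb
  rw [← hf.tsum_eq hsupp]
  refine (ENNReal.tsum_le_tsum fun w => ?_).trans
    (tsum_plost_le_one N.τ_pos.le N.τ_lt_one.le (applyOp (U.choose a.1 a.2).op a.2.2))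
  simp only [kernel, NPLCS.stepProb, f]
  split_ifs <;> simp

/-- The step of the chain in which every message is lost. -/
def lossStep (U : Scheduler N) (a : List (Conf Q C M) × Conf Q C M) :
    List (Conf Q C M) × Conf Q C M :=
  (a.1 ++ [a.2], (U.choose a.1 a.2).dst, eps C M)

theorem kernel_lossStep_ne_zero (U : Scheduler N) (a : List (Conf Q C M) × Conf Q C M) :
    U.kernel a (U.lossStep a) ≠ 0 := by
  simpa [kernel, lossStep, NPLCS.stepProb, U.choose_mem, U.choose_enabled]
    using plost_eps_ne_zero N.τ_pos _

end Scheduler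

/-- If some scheduler satisfies `□A` almost surely from `(x,ε)`, then
`x ∈ Safe(A)`. -/
theorem statement2 {Q C M : Type} [Fintype Q] [Fintype C] [DecidableEq C]
    [Fintype M] [DecidableEq M] (N : NPLCS Q C M) (A : Set Q) (x : Q)
    (h : ∃ U : Scheduler N, U.Pr (x, eps C M) (evAlways (inLoc A)) = 1) :
    x ∈ N.L.Safe A := by
  obtain ⟨U, hU⟩ := h
  let ω₀ : ℕ → List (Conf Q C M) × Conf Q C M := fun n => U.lossStep^[n] ([], (x, eps C M))
  have hsucc : ∀ n, ω₀ (n + 1) = U.lossStep (ω₀ n) := fun n => Function.iterate_succ_apply' _ _ _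
  have heps : ∀ n, (ω₀ n).2.2 = eps C M := by
    rintro (_ | n)
    · rfl
    · rw [hsucc]
      rfl
  refine Set.mem_sUnion.2 ⟨Set.range fun n => (ω₀ n).2.1, ⟨?_, ?_⟩, 0, rfl⟩
  · rintro _ ⟨n, rfl⟩
    obtain ⟨ω, hω, h0, hn⟩ := exists_mem_of_chainPr_eq_one U.tsum_kernel_le_one (ω₀ := ω₀)
      (fun i => by rw [hsucc]; exact U.kernel_lossStep_ne_zero _) hU n
    have heq : ω n = ω₀ n := by
      cases n with
      | zero => exact h0
      | succ n => exact hn n n.lt_succ_self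
    have : (ω n).2.1 ∈ A := hω n
    rwa [heq] at this
  · rintro _ ⟨n, rfl⟩
    refine ⟨(ω₀ (n + 1)).2, ?_, n + 1, rfl⟩
    have hconf : ((ω₀ n).2.1, eps C M) = (ω₀ n).2 := Prod.ext rfl (heps n).symm
    dsimp only
    rw [hconf, hsucc]
    exact ⟨U.choose _ _, U.choose_mem _ _, U.choose_enabled _ _, rfl,
      fun _ => List.nil_sublist _⟩

end NPLCSmodel
end

section
/- For every lossy channel system L and every family (A_i)_{i∈I} of sets of locations, Prom(⋃_{i∈I} A_i) = ⋃_{i∈I} Prom(A_i). -/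
open scoped ENNReal
open Classical

namespace NPLCSmodel

variable {Q C M : Type}

variable [DecidableEq C]

variable [Fintype C] [DecidableEq M]

variable {N : NPLCS Q C M}

namespace LCS

variable {Q C M : Type} [DecidableEq C]

theorem ReachWithin.mono {L : LCS Q C M} {X Y : Set Q} (h : X ⊆ Y) {s t : Conf Q C M}
    (hst : L.ReachWithin X s t) : L.ReachWithin Y s t :=
  Relation.ReflTransGen.mono (fun _ _ hab => ⟨hab.1, h hab.2⟩) _ _ hst

/-- A path starting with empty channels may lose all messages at its end. -/
theorem ReachWithin.to_eps {L : LCS Q C M} {X : Set Q} {q : Q} {t : Conf Q C M}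
    (h : L.ReachWithin X (q, eps C M) t) : L.ReachWithin X (q, eps C M) (t.1, eps C M) := by
  cases h with
  | refl => exact .refl
  | tail hs hstep =>
    obtain ⟨⟨δ, hδ, hen, hdst, -⟩, hX⟩ := hstep
    exact .tail hs ⟨⟨δ, hδ, hen, hdst, fun _ => List.nil_sublist _⟩, hX⟩

/-- A path can be cut at its first visit to `V`, if any. -/
theorem ReachWithin.exists_first_visit {L : LCS Q C M} {X : Set Q} (V : Set Q)
    {s t : Conf Q C M} (h : L.ReachWithin X s t) :
    ∃ t', L.ReachWithin (X \ V) s t' ∧ (t' = t ∨ t'.1 ∈ V) := by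
  induction h with
  | refl => exact ⟨s, .refl, .inl rfl⟩
  | @tail a b _ hstep ih =>
    by_cases ha : a.1 ∈ V
    · obtain ⟨t', ht', rfl | hV⟩ := ih
      · exact ⟨t', ht', .inr ha⟩
      · exact ⟨t', ht', .inr hV⟩
    · obtain ⟨t', ht', rfl | hV⟩ := ih
      · exact ⟨b, .tail ht' ⟨hstep.1, hstep.2, ha⟩, .inl rfl⟩
      · exact ⟨t', ht', .inr hV⟩

/-- The locations of `U` that can be reached inside `U` from `q` with empty channels. -/
def reachSet (L : LCS Q C M) (U : Set Q) (q : Q) : Set Q :=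
  {y | y ∈ U ∧ L.ReachWithin U (q, eps C M) (y, eps C M)}

theorem mem_reachSet_self (L : LCS Q C M) {U : Set Q} {q : Q} (hq : q ∈ U) :
    q ∈ L.reachSet U q :=
  ⟨hq, .refl⟩

theorem reachSet_subset_of_mem {L : LCS Q C M} {U : Set Q} {q y : Q}
    (hy : y ∈ L.reachSet U q) : L.reachSet U y ⊆ L.reachSet U q :=
  fun _ hx => ⟨hx.1, hy.2.trans hx.2⟩

theorem ReachWithin.within_reachSet {L : LCS Q C M} {U : Set Q} {q : Q} {t : Conf Q C M}
    (h : L.ReachWithin U (q, eps C M) t) :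
    L.ReachWithin (L.reachSet U q) (q, eps C M) t := by
  induction h with
  | refl => exact .refl
  | tail hs hstep ih => exact .tail ih ⟨hstep.1, hstep.2, ReachWithin.to_eps hs⟩

theorem isPromisingFor_prom (L : LCS Q C M) (A : Set Q) : L.IsPromisingFor A (L.Prom A) := by
  rintro x ⟨X, hX, hx⟩
  obtain ⟨t, ht, htA⟩ := hX x hx
  exact ⟨t, ht.mono (Set.subset_sUnion_of_mem hX), htA⟩

theorem IsPromisingFor.subset_prom {L : LCS Q C M} {A X : Set Q}
    (h : L.IsPromisingFor A X) : X ⊆ L.Prom A :=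
  Set.subset_sUnion_of_mem h

theorem subset_prom (L : LCS Q C M) (A : Set Q) : A ⊆ L.Prom A :=
  IsPromisingFor.subset_prom fun x hx => ⟨(x, eps C M), .refl, hx⟩

theorem prom_mono (L : LCS Q C M) {A B : Set Q} (h : A ⊆ B) : L.Prom A ⊆ L.Prom B :=
  IsPromisingFor.subset_prom fun x hx =>
    let ⟨t, ht, htA⟩ := L.isPromisingFor_prom A x hx
    ⟨t, ht, h htA⟩

/-- A set from which `Prom(A)` can be reached everywhere is contained in `Prom(A)`. -/
theorem IsPromisingFor.subset_prom_of_prom {L : LCS Q C M} {A X : Set Q}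
    (h : L.IsPromisingFor (L.Prom A) X) : X ⊆ L.Prom A := by
  refine Set.subset_union_left.trans
    (IsPromisingFor.subset_prom (X := X ∪ L.Prom A) ?_)
  have hprom : ∀ y ∈ L.Prom A,
      ∃ t, L.ReachWithin (X ∪ L.Prom A) (y, eps C M) t ∧ t.1 ∈ A := fun y hy =>
    let ⟨t, ht, htA⟩ := L.isPromisingFor_prom A y hy
    ⟨t, ht.mono Set.subset_union_right, htA⟩
  rintro x (hx | hx)
  · obtain ⟨t, ht, htA⟩ := h x hx
    obtain ⟨u, hu, huA⟩ := hprom t.1 htA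
    exact ⟨u, (ht.to_eps.mono Set.subset_union_left).trans hu, huA⟩
  · exact hprom x hx

theorem prom_iUnion_subset [Finite Q] (L : LCS Q C M) {ι : Type*} (A : ι → Set Q) :
    L.Prom (⋃ i, A i) ⊆ ⋃ i, L.Prom (A i) := by
  set V := ⋃ i, L.Prom (A i) with hV
  set U := L.Prom (⋃ i, A i) \ V with hU
  rw [← Set.sdiff_eq_empty]
  by_contra hne
  -- A location of a bottom strongly connected component of `U`.
  obtain ⟨z, hzU, hmin⟩ :=
    (Set.toFinite U).exists_minimalFor (L.reachSet U) U (Set.nonempty_iff_ne_empty.2 hne)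
  obtain ⟨t, ht, htA⟩ := L.isPromisingFor_prom _ z hzU.1
  obtain ⟨t', ht', hcases⟩ := ht.exists_first_visit V
  have htV : t'.1 ∈ V := by
    rcases hcases with rfl | h
    · exact Set.iUnion_mono (fun i => L.subset_prom (A i)) htA
    · exact h
  obtain ⟨i, hi⟩ := Set.mem_iUnion.1 htV
  have hprom : L.IsPromisingFor (L.Prom (A i)) (L.reachSet U z) := by
    intro y hy
    have hyz : z ∈ L.reachSet U y :=
      hmin hy.1 (reachSet_subset_of_mem hy) (L.mem_reachSet_self hzU)
    exact ⟨t', (hyz.2.within_reachSet.mono (reachSet_subset_of_mem hy)).trans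
      (ReachWithin.within_reachSet ht'), hi⟩
  exact hzU.2 (Set.mem_iUnion.2 ⟨i, hprom.subset_prom_of_prom (L.mem_reachSet_self hzU)⟩)

end LCS

/-- `Prom` distributes over arbitrary unions. -/
theorem statement3 {Q C M : Type} [Fintype Q] [Fintype C] [DecidableEq C]
    [Fintype M] [DecidableEq M] (L : LCS Q C M) {ι : Type} (A : ι → Set Q) :
    L.Prom (⋃ i, A i) = ⋃ i, L.Prom (A i) := by
  exact (L.prom_iUnion_subset A).antisymm
    (Set.iUnion_subset fun i => L.prom_mono (Set.subset_iUnion A i))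

end NPLCSmodel
end
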